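/- M(3,3) = 13. That is, over all acyclic directed graphs G with two distinct sources S_1, S_2 and two distinct sinks R_1, R_2 in which the min-cut from S_1 to R_1 and from S_2 to R_2 are both 3, the largest possible value of the minimum number of mergings between a set of 3 edge-disjoint paths from S_1 to R_1 and a set of 3 edge-disjoint paths from S_2 to R_2 (minimized over all choices of the two Menger path systems) equals 13. -/

import Mathlib

/-- A finite directed multigraph. -/
structure MultiDigraph where
  V : Type
  E : Type
  fintV : Fintype V
  fintE : Fintype E
  src : E → V
  dst : E → V

namespace MultiDigraph

/-- `p` is a (nonempty) directed path from `u` to `v`, given as its list of edges. -/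
def IsPathFrom (G : MultiDigraph) (u v : G.V) (p : List G.E) : Prop :=
  p ≠ [] ∧ List.Chain' (fun e f => G.dst e = G.src f) p ∧
    (∀ e ∈ p.head?, G.src e = u) ∧ ∀ e ∈ p.getLast?, G.dst e = v

/-- `G` is acyclic: there is no (nonempty) directed path from a vertex to itself. -/
def Acyclic (G : MultiDigraph) : Prop :=
  ∀ (v : G.V) (p : List G.E), ¬ G.IsPathFrom v v p

/-- `α` is a family of `c` pairwise edge-disjoint directed paths from `u` to `v`. -/
def MengerSystem (G : MultiDigraph) (u v : G.V) (c : ℕ) (α : Fin c → List G.E) : Prop :=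
  (∀ i, G.IsPathFrom u v (α i)) ∧ ∀ i j, i ≠ j → ∀ e, e ∈ α i → e ∉ α j

/-- The min-cut between `u` and `v` equals `c`: by Menger's theorem, this means the
maximum number of pairwise edge-disjoint directed paths from `u` to `v` is exactly `c`. -/
def MinCut (G : MultiDigraph) (u v : G.V) (c : ℕ) : Prop :=
  (∃ α : Fin c → List G.E, G.MengerSystem u v c α) ∧
    ¬∃ α : Fin (c + 1) → List G.E, G.MengerSystem u v (c + 1) α

/-- Edge `e` is the starting edge of a merging among paths from (at least) two different
groups: `e` lies on a path of group `i` and on a path of group `j ≠ i`, and there are two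
distinct edges immediately ahead of `e` on these two paths.  Mergings are counted without
multiplicity: one merging per such edge `e`. -/
def MergingEdge (G : MultiDigraph) {l : ℕ} {c : Fin l → ℕ}
    (α : (i : Fin l) → Fin (c i) → List G.E) (e : G.E) : Prop :=
  ∃ i j : Fin l, i ≠ j ∧ ∃ (a : Fin (c i)) (b : Fin (c j)) (f g : G.E),
    f ≠ g ∧ [f, e] <:+: α i a ∧ [g, e] <:+: α j b

/-- The number of mergings among paths from different groups, `|G|_M(α₁,…,α_l)`. -/
noncomputable def mergingCount (G : MultiDigraph) {l : ℕ} {c : Fin l → ℕ}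
    (α : (i : Fin l) → Fin (c i) → List G.E) : ℕ :=
  Set.ncard {e : G.E | G.MergingEdge α e}

end MultiDigraph

open MultiDigraph

/-- `G` is a finite acyclic directed multigraph with designated sources `S i`, pairwise
distinct sinks `R i`, and min-cut `c i` between `S i` and `R i`. -/
def GoodConfig {l : ℕ} (G : MultiDigraph) (S R : Fin l → G.V) (c : Fin l → ℕ) : Prop :=
  G.Acyclic ∧ Function.Injective R ∧ ∀ i, G.MinCut (S i) (R i) (c i)

/-- `M(c₁,…,c_l) ≤ B`: in every acyclic graph with distinct sources, distinct sinks and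
the given min-cuts, some choice of Menger path systems yields at most `B` mergings. -/
def MAtMost {l : ℕ} (c : Fin l → ℕ) (B : ℕ) : Prop :=
  ∀ (G : MultiDigraph) (S R : Fin l → G.V), GoodConfig G S R c → Function.Injective S →
    ∃ α : (i : Fin l) → Fin (c i) → List G.E,
      (∀ i, G.MengerSystem (S i) (R i) (c i) (α i)) ∧ G.mergingCount α ≤ B

/-- `M(c₁,…,c_l) ≥ B`: some acyclic graph with distinct sources, distinct sinks and the
given min-cuts yields at least `B` mergings for every choice of Menger path systems. -/
def MAtLeast {l : ℕ} (c : Fin l → ℕ) (B : ℕ) : Prop :=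
  ∃ (G : MultiDigraph) (S R : Fin l → G.V), GoodConfig G S R c ∧ Function.Injective S ∧
    ∀ α : (i : Fin l) → Fin (c i) → List G.E,
      (∀ i, G.MengerSystem (S i) (R i) (c i) (α i)) → B ≤ G.mergingCount α

/-- `M(c₁,…,c_l) = B`: the largest possible value, over all acyclic graphs with distinct
sources and distinct sinks realizing the min-cuts `c`, of the minimum number of mergings
over all choices of Menger path systems, equals `B`. -/
def MEq {l : ℕ} (c : Fin l → ℕ) (B : ℕ) : Prop := MAtMost c B ∧ MAtLeast c B

/-- `M*(c₁,…,c_l) ≤ B`: as `MAtMost`, but with all sources identical. -/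
def MstarAtMost {l : ℕ} (c : Fin l → ℕ) (B : ℕ) : Prop :=
  ∀ (G : MultiDigraph) (S R : Fin l → G.V), GoodConfig G S R c → (∀ i j, S i = S j) →
    ∃ α : (i : Fin l) → Fin (c i) → List G.E,
      (∀ i, G.MengerSystem (S i) (R i) (c i) (α i)) ∧ G.mergingCount α ≤ B

/-- `M*(c₁,…,c_l) ≥ B`: as `MAtLeast`, but with all sources identical. -/
def MstarAtLeast {l : ℕ} (c : Fin l → ℕ) (B : ℕ) : Prop :=
  ∃ (G : MultiDigraph) (S R : Fin l → G.V), GoodConfig G S R c ∧ (∀ i j, S i = S j) ∧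
    ∀ α : (i : Fin l) → Fin (c i) → List G.E,
      (∀ i, G.MengerSystem (S i) (R i) (c i) (α i)) → B ≤ G.mergingCount α

/-- `M*(c₁,…,c_l) = B`: as `MEq`, but with all sources identical. -/
def MstarEq {l : ℕ} (c : Fin l → ℕ) (B : ℕ) : Prop := MstarAtMost c B ∧ MstarAtLeast c B

namespace M33

/-- `hm l` has bit `X` set iff `l ∈ X` (subsets of `{0,…,5}` coded as numbers below 64). -/
def hm (l : Nat) : Nat :=
  match l with
  | 0 => 0xAAAAAAAAAAAAAAAA
  | 1 => 0xCCCCCCCCCCCCCCCC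
  | 2 => 0xF0F0F0F0F0F0F0F0
  | 3 => 0xFF00FF00FF00FF00
  | 4 => 0xFFFF0000FFFF0000
  | _ => 0xFFFFFFFF00000000

def mNB (f g : Nat) : Nat := Nat.sub 0xFFFFFFFFFFFFFFFF (Nat.land (hm f) (hm g))
def mL (f g : Nat) : Nat := Nat.sub (hm f) (Nat.land (hm f) (hm g))
def mR (f g : Nat) : Nat := Nat.sub (hm g) (Nat.land (hm f) (hm g))
def shf (f g : Nat) : Nat := Nat.sub (Nat.pow 2 g) (Nat.pow 2 f)

def stepF (F f g : Nat) : Nat :=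
  Nat.lor (Nat.land F (mNB f g))
    (Nat.lor (Nat.shiftLeft (Nat.land F (mL f g)) (shf f g))
      (Nat.shiftRight (Nat.land F (mR f g)) (shf f g)))

def cA (i j : Nat) : Nat := Nat.add (Nat.sub 7 (Nat.pow 2 i)) (Nat.pow 2 (Nat.add 3 j))
def cB (i j : Nat) : Nat := Nat.add (Nat.sub 56 (Nat.pow 2 (Nat.add 3 j))) (Nat.pow 2 i)

def tb (F m : Nat) : Bool := Nat.beq (Nat.land (Nat.shiftRight F m) 1) 1

def bad (F G i j : Nat) : Bool := or (tb F (cA i j)) (tb G (cB i j))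

inductive Tr where
  | leaf : Tr
  | node : Tr → Nat → Nat → Nat → Nat → Tr → Tr

def force (n : Nat) (k : Nat → Bool) : Bool :=
  match n with
  | 0 => k 0
  | Nat.succ m => k (Nat.succ m)

noncomputable def ins (F G r c : Nat) (t : Tr) : (Tr → Bool) → Bool :=
  Tr.rec (motive := fun _ => (Tr → Bool) → Bool) (fun k => k (.node .leaf F G r c .leaf))
    (fun a F' G' r' c' b iha ihb k =>
    bif Nat.blt F F' then iha (fun a' => k (.node a' F' G' r' c' b))
    else bif Nat.blt F' F then ihb (fun b' => k (.node a F' G' r' c' b'))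
    else bif Nat.blt G G' then iha (fun a' => k (.node a' F' G' r' c' b))
    else bif and (Nat.beq G G') (and (Nat.beq r r') (Nat.beq c c')) then k (.node a F' G' r' c' b)
    else ihb (fun b' => k (.node a F' G' r' c' b'))) t

def upd (i r : Nat) : Nat := bif Nat.blt i r then r else Nat.succ i

noncomputable def ex1 (F G r c i j : Nat) (acc : Tr) (k : Tr → Bool) : Bool :=
  bif or (Nat.blt r i) (or (Nat.blt c j) (bad F G i j)) then k acc
  else force (stepF F i (Nat.add 3 j)) fun F' => force (stepF G i (Nat.add 3 j)) fun G' =>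
    force (upd i r) fun r' => force (upd j c) fun c' => ins F' G' r' c' acc k

noncomputable def ex3 (F G r c i : Nat) (acc : Tr) (k : Tr → Bool) : Bool :=
  ex1 F G r c i 0 acc fun a => ex1 F G r c i 1 a fun a => ex1 F G r c i 2 a k

noncomputable def ex9 (F G r c : Nat) (acc : Tr) (k : Tr → Bool) : Bool :=
  ex3 F G r c 0 acc fun a => ex3 F G r c 1 a fun a => ex3 F G r c 2 a k

noncomputable def exT (t : Tr) : Tr → (Tr → Bool) → Bool :=
  Tr.rec (motive := fun _ => Tr → (Tr → Bool) → Bool) (fun acc k => k acc)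
    (fun _ F G r c _ iha ihb acc k =>
    ex9 F G r c acc fun x => iha x fun y => ihb y k) t

noncomputable def bfs : Nat → Tr → Bool
  | _, .leaf => true
  | 0, .node _ _ _ _ _ _ => false
  | n+1, .node a F G r c b => exT (.node a F G r c b) .leaf fun t => bfs n t

def t0 : Tr := .node .leaf (2^7) (2^56) 0 0 .leaf
theorem bfs_ok : bfs 14 t0 = true := by decide +kernel

/-! ### Soundness of the search -/

def Mem (F G r c : Nat) : Tr → Prop
  | .leaf => False
  | .node a F' G' r' c' b => Mem F G r c a ∨ (F = F' ∧ G = G' ∧ r = r' ∧ c = c') ∨ Mem F G r c b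

def Sub (t t' : Tr) : Prop := ∀ F G r c, Mem F G r c t → Mem F G r c t'

theorem Sub.rfl' (t : Tr) : Sub t t := fun _ _ _ _ h => h

theorem force_eq (n : Nat) (k : Nat → Bool) : force n k = k n := by
  cases n <;> rfl

theorem ins_sound (F G r c : Nat) (t : Tr) : ∀ k : Tr → Bool, ins F G r c t k = true →
    ∃ t', Sub t t' ∧ Mem F G r c t' ∧ k t' = true := by
  induction t with
  | leaf =>
    intro k h
    exact ⟨_, fun _ _ _ _ h => h.elim, by simp [Mem], h⟩
  | node a F' G' r' c' b iha ihb =>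
    intro k h
    have hA : ins F G r c a (fun a' => k (.node a' F' G' r' c' b)) = true →
        ∃ t', Sub (.node a F' G' r' c' b) t' ∧ Mem F G r c t' ∧ k t' = true := by
      intro h
      obtain ⟨t', h1, h2, h3⟩ := iha _ h
      refine ⟨.node t' F' G' r' c' b, ?_, Or.inl h2, h3⟩
      intro p q u v hm
      rcases hm with hm | hm
      · exact Or.inl (h1 _ _ _ _ hm)
      · exact Or.inr hm
    have hB : ins F G r c b (fun b' => k (.node a F' G' r' c' b')) = true →
        ∃ t', Sub (.node a F' G' r' c' b) t' ∧ Mem F G r c t' ∧ k t' = true := by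
      intro h
      obtain ⟨t', h1, h2, h3⟩ := ihb _ h
      refine ⟨.node a F' G' r' c' t', ?_, Or.inr (Or.inr h2), h3⟩
      intro p q u v hm
      rcases hm with hm | hm | hm
      · exact Or.inl hm
      · exact Or.inr (Or.inl hm)
      · exact Or.inr (Or.inr (h1 _ _ _ _ hm))
    change (bif Nat.blt F F' then ins F G r c a (fun a' => k (.node a' F' G' r' c' b))
      else bif Nat.blt F' F then ins F G r c b (fun b' => k (.node a F' G' r' c' b'))
      else bif Nat.blt G G' then ins F G r c a (fun a' => k (.node a' F' G' r' c' b))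
      else bif and (Nat.beq G G') (and (Nat.beq r r') (Nat.beq c c')) then
        k (.node a F' G' r' c' b)
      else ins F G r c b (fun b' => k (.node a F' G' r' c' b'))) = true at h
    cases h1 : Nat.blt F F' with
    | true => rw [h1] at h; exact hA h
    | false =>
      cases h2 : Nat.blt F' F with
      | true => rw [h1, h2] at h; exact hB h
      | false =>
        cases h3 : Nat.blt G G' with
        | true => rw [h1, h2, h3] at h; exact hA h
        | false =>
          cases h4 : and (Nat.beq G G') (and (Nat.beq r r') (Nat.beq c c')) with
          | false => rw [h1, h2, h3, h4] at h; exact hB h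
          | true =>
            rw [h1, h2, h3, h4] at h
            refine ⟨_, Sub.rfl' _, Or.inr (Or.inl ?_), h⟩
            have h1' : ¬ F < F' := fun hh => by
              rw [← Nat.blt_eq] at hh; rw [h1] at hh; exact absurd hh (by decide)
            have h2' : ¬ F' < F := fun hh => by
              rw [← Nat.blt_eq] at hh; rw [h2] at hh; exact absurd hh (by decide)
            rw [Bool.and_eq_true, Bool.and_eq_true] at h4
            exact ⟨by omega, Nat.eq_of_beq_eq_true h4.1, Nat.eq_of_beq_eq_true h4.2.1,
              Nat.eq_of_beq_eq_true h4.2.2⟩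

def Succ1 (F G r c i j : Nat) (t : Tr) : Prop :=
  i ≤ r → j ≤ c → bad F G i j = false →
    Mem (stepF F i (3 + j)) (stepF G i (3 + j)) (upd i r) (upd j c) t

theorem Succ1.mono {F G r c i j : Nat} {t t' : Tr} (h : Succ1 F G r c i j t) (hs : Sub t t') :
    Succ1 F G r c i j t' := fun a b d => hs _ _ _ _ (h a b d)

theorem ex1_sound (F G r c i j : Nat) (t : Tr) (k : Tr → Bool)
    (h : ex1 F G r c i j t k = true) :
    ∃ t', Sub t t' ∧ Succ1 F G r c i j t' ∧ k t' = true := by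
  unfold ex1 at h
  cases hb : or (Nat.blt r i) (or (Nat.blt c j) (bad F G i j)) with
  | true =>
    rw [hb] at h
    refine ⟨t, Sub.rfl' _, ?_, h⟩
    intro h1 h2 h3
    rw [h3, Bool.or_eq_true, Bool.or_eq_true, Nat.blt_eq, Nat.blt_eq] at hb
    rcases hb with hb | hb | hb
    · omega
    · omega
    · exact absurd hb (by decide)
  | false =>
    rw [hb] at h
    simp only [cond_false, force_eq] at h
    obtain ⟨t', h1, h2, h3⟩ := ins_sound _ _ _ _ _ _ h
    exact ⟨t', h1, fun _ _ _ => h2, h3⟩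

theorem Sub.trans' {a b c : Tr} (h : Sub a b) (h' : Sub b c) : Sub a c :=
  fun _ _ _ _ x => h' _ _ _ _ (h _ _ _ _ x)

theorem ex3_sound (F G r c i : Nat) (t : Tr) (k : Tr → Bool)
    (h : ex3 F G r c i t k = true) :
    ∃ t', Sub t t' ∧ (∀ j < 3, Succ1 F G r c i j t') ∧ k t' = true := by
  obtain ⟨t1, a1, b1, h⟩ := ex1_sound _ _ _ _ _ _ _ _ h
  obtain ⟨t2, a2, b2, h⟩ := ex1_sound _ _ _ _ _ _ _ _ h
  obtain ⟨t3, a3, b3, h⟩ := ex1_sound _ _ _ _ _ _ _ _ h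
  refine ⟨t3, (a1.trans' a2).trans' a3, ?_, h⟩
  intro j hj
  interval_cases j
  · exact b1.mono (a2.trans' a3)
  · exact b2.mono a3
  · exact b3

theorem ex9_sound (F G r c : Nat) (t : Tr) (k : Tr → Bool)
    (h : ex9 F G r c t k = true) :
    ∃ t', Sub t t' ∧ (∀ i < 3, ∀ j < 3, Succ1 F G r c i j t') ∧ k t' = true := by
  obtain ⟨t1, a1, b1, h⟩ := ex3_sound _ _ _ _ _ _ _ h
  obtain ⟨t2, a2, b2, h⟩ := ex3_sound _ _ _ _ _ _ _ h
  obtain ⟨t3, a3, b3, h⟩ := ex3_sound _ _ _ _ _ _ _ h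
  refine ⟨t3, (a1.trans' a2).trans' a3, ?_, h⟩
  intro i hi j hj
  interval_cases i
  · exact (b1 j hj).mono (a2.trans' a3)
  · exact (b2 j hj).mono a3
  · exact b3 j hj

theorem exT_sound (s : Tr) : ∀ (t : Tr) (k : Tr → Bool), exT s t k = true →
    ∃ t', Sub t t' ∧ (∀ F G r c, Mem F G r c s → ∀ i < 3, ∀ j < 3, Succ1 F G r c i j t') ∧
      k t' = true := by
  induction s with
  | leaf =>
    intro t k h
    exact ⟨t, Sub.rfl' _, fun _ _ _ _ h => h.elim, h⟩
  | node a F' G' r' c' b iha ihb =>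
    intro t k h
    change ex9 F' G' r' c' t (fun x => exT a x fun y => exT b y k) = true at h
    obtain ⟨t1, a1, b1, h⟩ := ex9_sound _ _ _ _ _ _ h
    obtain ⟨t2, a2, b2, h⟩ := iha _ _ h
    obtain ⟨t3, a3, b3, h⟩ := ihb _ _ h
    refine ⟨t3, (a1.trans' a2).trans' a3, ?_, h⟩
    intro F G r c hm i hi j hj
    rcases hm with hm | ⟨rfl, rfl, rfl, rfl⟩ | hm
    · exact (b2 _ _ _ _ hm i hi j hj).mono a3
    · exact (b1 i hi j hj).mono (a2.trans' a3)
    · exact b3 _ _ _ _ hm i hi j hj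

abbrev Ltr := Fin 3 × Fin 3

def stp (s : Option (ℕ × ℕ)) (x : Ltr) : Option (ℕ × ℕ) :=
  match s with
  | none => none
  | some s => if bad s.1 s.2 x.1 x.2 = true then none
      else some (stepF s.1 x.1 (3 + x.2), stepF s.2 x.1 (3 + x.2))

def norm (r : ℕ) : List (Fin 3) → Prop
  | [] => True
  | x :: l => x.val ≤ r ∧ norm (upd x r) l

theorem foldl_none (w : List Ltr) : w.foldl stp none = none := by
  induction w with
  | nil => rfl
  | cons x w ih => exact ih

theorem bfs_sound (n : ℕ) : ∀ (t : Tr), bfs n t = true → ∀ F G r c, Mem F G r c t →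
    ∀ w : List Ltr, norm r (w.map Prod.fst) → norm c (w.map Prod.snd) →
      w.foldl stp (some (F, G)) ≠ none → w.length < n := by
  induction n with
  | zero =>
    intro t h F G r c hm
    cases t with
    | leaf => exact hm.elim
    | node => exact absurd h (by simp [bfs])
  | succ n ih =>
    intro t h F G r c hm w hr hc hw
    cases t with
    | leaf => exact hm.elim
    | node a F' G' r' c' b =>
      obtain ⟨t', -, h1, h2⟩ := exT_sound _ _ _ h
      cases w with
      | nil => simp
      | cons x w =>
        have hx : bad F G x.1 x.2 = false := by
          by_contra hb
          apply hw
          rw [Bool.not_eq_false] at hb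
          simp [stp, hb, foldl_none]
        have := ih t' h2 _ _ _ _ (h1 F G r c hm x.1 x.1.2 x.2 x.2.2 hr.1 hc.1 hx) w hr.2 hc.2
          (by simpa [stp, hx] using hw)
        simpa using this

theorem norm_perm (l : List (Fin 3)) : ∀ (r : ℕ) (τ : Fin 3 → Fin 3), ∃ π : Equiv.Perm (Fin 3),
    (∀ x : Fin 3, x.val < r → π x = x) ∧ norm r (l.map (fun x => π (τ x))) := by
  induction l with
  | nil => exact fun r _ => ⟨1, fun _ _ => rfl, trivial⟩
  | cons x l ih =>
    intro r τ
    by_cases hx : (τ x).val < r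
    · obtain ⟨π, h1, h2⟩ := ih r τ
      refine ⟨π, h1, ?_⟩
      have hu : upd (τ x).val r = r := by
        unfold upd; rw [show Nat.blt (τ x).val r = true by rw [Nat.blt_eq]; exact hx]; rfl
      simp only [List.map_cons, norm, h1 _ hx, hu]
      exact ⟨hx.le, h2⟩
    · have hr : r < 3 := by have := (τ x).2; omega
      let y : Fin 3 := ⟨r, hr⟩
      obtain ⟨π, h1, h2⟩ := ih (r + 1) (fun z => Equiv.swap (τ x) y (τ z))
      refine ⟨(Equiv.swap (τ x) y).trans π, ?_, ?_⟩
      · intro z hz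
        rw [Equiv.trans_apply, Equiv.swap_apply_of_ne_of_ne, h1 z (by omega)]
        · rintro rfl; exact hx hz
        · intro h; rw [h] at hz; exact absurd hz (lt_irrefl _)
      · have hu : upd r r = r + 1 := by
          unfold upd
          rw [show Nat.blt r r = false by
            rw [← Bool.not_eq_true, Nat.blt_eq]; exact lt_irrefl _]; rfl
        have hy : π y = y := h1 y (Nat.lt_succ_self r)
        simp only [List.map_cons, norm, Equiv.trans_apply, Equiv.swap_apply_left, hy]
        refine ⟨le_rfl, ?_⟩
        rw [show (y : ℕ) = r from rfl, hu]
        exact h2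

def run (w : List Ltr) : Option (ℕ × ℕ) := w.foldl stp (some (2 ^ 7, 2 ^ 56))

/-- Up to relabelling, no word of length at least 14 survives. -/
theorem words_bound (w : List Ltr)
    (h : ∀ π σ : Equiv.Perm (Fin 3), run (w.map fun x => (π x.1, σ x.2)) ≠ none) :
    w.length < 14 := by
  obtain ⟨π, -, hπ⟩ := norm_perm (w.map Prod.fst) 0 id
  obtain ⟨σ, -, hσ⟩ := norm_perm (w.map Prod.snd) 0 id
  have := bfs_sound 14 t0 bfs_ok (2 ^ 7) (2 ^ 56) 0 0 (Or.inr (Or.inl ⟨rfl, rfl, rfl, rfl⟩))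
    (w.map fun x : Ltr => (π x.1, σ x.2)) (by simpa [List.map_map, Function.comp_def] using hπ)
    (by simpa [List.map_map, Function.comp_def] using hσ) (h π σ)
  simpa using this

end M33

namespace M33

/-! ### Bit bookkeeping -/

theorem tb_eq (F m : ℕ) : tb F m = Nat.testBit F m := by
  rw [Bool.eq_iff_iff]
  unfold tb
  rw [Nat.beq_eq, Nat.testBit_eq_decide_div_mod_eq, decide_eq_true_iff]
  change (F >>> m) &&& 1 = 1 ↔ _
  rw [Nat.and_one_is_mod, Nat.shiftRight_eq_div_pow]

theorem stepF_bit (F f g m : ℕ) (h : tb (stepF F f g) m = true) :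
    (tb F m = true ∧ tb (mNB f g) m = true) ∨
    (shf f g ≤ m ∧ tb F (m - shf f g) = true ∧ tb (mL f g) (m - shf f g) = true) ∨
    (tb F (m + shf f g) = true ∧ tb (mR f g) (m + shf f g) = true) := by
  have e : stepF F f g = (F &&& mNB f g) ||| (((F &&& mL f g) <<< shf f g) |||
      ((F &&& mR f g) >>> shf f g)) := rfl
  rw [e] at h
  simp only [tb_eq] at h ⊢
  simp only [Nat.testBit_or, Nat.testBit_and, Nat.testBit_shiftLeft, Nat.testBit_shiftRight,
    Bool.or_eq_true, Bool.and_eq_true, decide_eq_true_eq] at h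
  rcases h with h | h | h
  · exact Or.inl h
  · exact Or.inr (Or.inl ⟨h.1, h.2⟩)
  · rw [add_comm] at h; exact Or.inr (Or.inr h)

def code (σ : Fin 3 → Fin 6) : ℕ := 2 ^ (σ 0).val + 2 ^ (σ 1).val + 2 ^ (σ 2).val

def lf (i : Fin 3) : Fin 6 := ⟨i, by omega⟩
def rg (j : Fin 3) : Fin 6 := ⟨3 + j, by omega⟩

def one (i j : Fin 3) (a b : Fin 6) : Bool :=
  !((a == lf i || a == rg j) && (b == lf i || b == rg j))

def sw (i j : Fin 3) (a : Fin 6) : Fin 6 :=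
  if a = lf i then rg j else if a = rg j then lf i else a

def cd (a b c : Fin 6) : ℕ := 2 ^ a.val + 2 ^ b.val + 2 ^ c.val

theorem fin1 : ∀ (i j : Fin 3) (a b c : Fin 6), a ≠ b → a ≠ c → b ≠ c →
    tb (mNB i (3 + j)) (cd a b c) = true →
    (one i j a b && one i j a c && one i j b c) = true := by decide +kernel

theorem fin2 : ∀ (i j : Fin 3) (a b c : Fin 6), a ≠ b → a ≠ c → b ≠ c →
    shf i (3 + j) ≤ cd a b c → tb (mL i (3 + j)) (cd a b c - shf i (3 + j)) = true →
    (one i j a b && one i j a c && one i j b c) = true ∧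
      cd (sw i j a) (sw i j b) (sw i j c) = cd a b c - shf i (3 + j) := by decide +kernel

theorem fin3 : ∀ (i j : Fin 3) (a b c : Fin 6), a ≠ b → a ≠ c → b ≠ c →
    tb (mR i (3 + j)) (cd a b c + shf i (3 + j)) = true →
    (one i j a b && one i j a c && one i j b c) = true ∧
      cd (sw i j a) (sw i j b) (sw i j c) = cd a b c + shf i (3 + j) := by decide +kernel

theorem sw_sw (i j : Fin 3) (a : Fin 6) : sw i j (sw i j a) = a := by
  revert i j a; decide

theorem sw_spec (i j : Fin 3) (a : Fin 6) :
    ((sw i j a = lf i ∨ sw i j a = rg j) ∧ (a = lf i ∨ a = rg j)) ∨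
    (a = sw i j a ∧ ¬ (sw i j a = lf i ∨ sw i j a = rg j)) := by
  revert i j a; decide

theorem one_uniq {i j : Fin 3} {σ : Fin 3 → Fin 6}
    (h : (one i j (σ 0) (σ 1) && one i j (σ 0) (σ 2) && one i j (σ 1) (σ 2)) = true) (k k' : Fin 3)
    (hk : σ k = lf i ∨ σ k = rg j) (hk' : σ k' = lf i ∨ σ k' = rg j) : k = k' := by
  have aux : ∀ a b : Fin 6, one i j a b = true → (a = lf i ∨ a = rg j) →
      (b = lf i ∨ b = rg j) → False := by
    intro a b h1 h2 h3
    simp [one] at h1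
    tauto
  rw [Bool.and_eq_true, Bool.and_eq_true] at h
  obtain ⟨⟨h1, h2⟩, h3⟩ := h
  fin_cases k <;> fin_cases k' <;> first
    | rfl
    | exact (aux _ _ h1 hk hk').elim
    | exact (aux _ _ h1 hk' hk).elim
    | exact (aux _ _ h2 hk hk').elim
    | exact (aux _ _ h2 hk' hk).elim
    | exact (aux _ _ h3 hk hk').elim
    | exact (aux _ _ h3 hk' hk).elim

theorem step_spec (F : ℕ) (i j : Fin 3) (σ' : Fin 3 → Fin 6) (hσ : Function.Injective σ')
    (h : tb (stepF F i (3 + j)) (code σ') = true) :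
    ∃ σ : Fin 3 → Fin 6, Function.Injective σ ∧ tb F (code σ) = true ∧
      (∀ k, ((σ k = lf i ∨ σ k = rg j) ∧ (σ' k = lf i ∨ σ' k = rg j)) ∨
        (σ' k = σ k ∧ ¬ (σ k = lf i ∨ σ k = rg j))) ∧
      (∀ k k', (σ k = lf i ∨ σ k = rg j) → (σ k' = lf i ∨ σ k' = rg j) → k = k') := by
  have n1 : σ' 0 ≠ σ' 1 := fun h => absurd (hσ h) (by decide)
  have n2 : σ' 0 ≠ σ' 2 := fun h => absurd (hσ h) (by decide)
  have n3 : σ' 1 ≠ σ' 2 := fun h => absurd (hσ h) (by decide)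
  have inj : Function.Injective (fun k => sw i j (σ' k)) := by
    intro k k' hk
    apply hσ
    have := congrArg (sw i j) hk
    simpa only [sw_sw] using this
  have uq : (one i j (σ' 0) (σ' 1) && one i j (σ' 0) (σ' 2) && one i j (σ' 1) (σ' 2)) = true →
      ∀ k k', (sw i j (σ' k) = lf i ∨ sw i j (σ' k) = rg j) →
        (sw i j (σ' k') = lf i ∨ sw i j (σ' k') = rg j) → k = k' := by
    intro ho k k' hk hk'
    refine one_uniq ho k k' ?_ ?_
    · rcases sw_spec i j (σ' k) with h | h
      · exact h.2
      · exact (h.2 hk).elim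
    · rcases sw_spec i j (σ' k') with h | h
      · exact h.2
      · exact (h.2 hk').elim
  rcases stepF_bit _ _ _ _ h with ⟨h1, h2⟩ | ⟨h1, h2, h3⟩ | ⟨h2, h3⟩
  · refine ⟨σ', hσ, h1, ?_, one_uniq (fin1 i j _ _ _ n1 n2 n3 h2)⟩
    intro k
    by_cases hk : σ' k = lf i ∨ σ' k = rg j
    · exact Or.inl ⟨hk, hk⟩
    · exact Or.inr ⟨rfl, hk⟩
  · obtain ⟨ho, hc⟩ := fin2 i j _ _ _ n1 n2 n3 h1 h3
    refine ⟨fun k => sw i j (σ' k), inj, ?_, fun k => sw_spec i j (σ' k), uq ho⟩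
    change tb F (cd _ _ _) = true
    rw [hc]; exact h2
  · obtain ⟨ho, hc⟩ := fin3 i j _ _ _ n1 n2 n3 h3
    refine ⟨fun k => sw i j (σ' k), inj, ?_, fun k => sw_spec i j (σ' k), uq ho⟩
    change tb F (cd _ _ _) = true
    rw [hc]; exact h2

theorem init1 : ∀ a b c : Fin 6, tb (2 ^ 7) (cd a b c) = true → a ≠ b → a ≠ c → b ≠ c →
    a.val < 3 ∧ b.val < 3 ∧ c.val < 3 := by decide +kernel

theorem init2 : ∀ a b c : Fin 6, tb (2 ^ 56) (cd a b c) = true → a ≠ b → a ≠ c → b ≠ c →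
    ¬ a.val < 3 ∧ ¬ b.val < 3 ∧ ¬ c.val < 3 := by decide +kernel

def repl (ι : Fin 3 → Fin 6) (i : Fin 3) (g : Fin 6) (k : Fin 3) : Fin 6 :=
  if k = i then g else ι k

theorem cA_eq : ∀ i j : Fin 3, cA i j = code (repl lf i (rg j)) := by decide +kernel
theorem cB_eq : ∀ i j : Fin 3, cB i j = code (repl rg j (lf i)) := by decide +kernel

theorem lf_inj : Function.Injective lf := by decide
theorem rg_inj : Function.Injective rg := by decide

theorem repl_inj {ι : Fin 3 → Fin 6} (hι : Function.Injective ι) (i : Fin 3) (g : Fin 6)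
    (hg : ∀ k, ι k ≠ g) : Function.Injective (repl ι i g) := by
  intro k k' h
  unfold repl at h
  split_ifs at h with h1 h2 h2
  · rw [h1, h2]
  · exact (hg _ h.symm).elim
  · exact (hg _ h).elim
  · exact hι h

end M33

namespace M33

/-! ### Linkages -/

section Link

variable {E : Type}

/-- `o` immediately precedes `e` in `l` (`none`: `e` is the first entry). -/
def Pred (l : List E) (o : Option E) (e : E) : Prop :=
  ∃ u v, l = u ++ e :: v ∧ u.getLast? = o

theorem Pred.mem {l : List E} {o : Option E} {e : E} (h : Pred l o e) : e ∈ l := by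
  obtain ⟨u, v, rfl, -⟩ := h; simp

theorem exists_pred {l : List E} {e : E} (h : e ∈ l) : ∃ o, Pred l o e := by
  obtain ⟨u, v, rfl⟩ := List.append_of_mem h
  exact ⟨_, u, v, rfl, rfl⟩

theorem Pred.append {p : List E} (s : List E) {o : Option E} {e : E} (h : Pred p o e) :
    Pred (p ++ s) o e := by
  obtain ⟨u, v, rfl, h⟩ := h
  exact ⟨u, v ++ s, by simp, h⟩

theorem pred_append {p p' s : List E} {o : Option E} {e : E} (hl : p.getLast? = p'.getLast?)
    (h : Pred (p ++ s) o e) : Pred p o e ∨ Pred (p' ++ s) o e := by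
  obtain ⟨u, v, h, ho⟩ := h
  rw [List.append_eq_append_iff] at h
  rcases h with ⟨a', rfl, h2⟩ | ⟨c', rfl, h2⟩
  · right
    refine ⟨p' ++ a', v, by rw [h2]; simp, ?_⟩
    rw [← ho]
    simp [List.getLast?_append, hl]
  · cases c' with
    | nil =>
      simp only [List.nil_append] at h2
      right
      refine ⟨p', v, by rw [h2], ?_⟩
      rw [← ho, ← hl]; simp
    | cons x c' =>
      simp only [List.cons_append, List.cons.injEq] at h2
      left
      obtain ⟨rfl, -⟩ := h2
      exact ⟨u, c', rfl, ho⟩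

theorem pred_snoc {p : List E} {o : Option E} {e x : E} (h : Pred (p ++ [x]) o e) :
    Pred p o e ∨ (o = p.getLast? ∧ e = x) := by
  obtain ⟨u, v, h, ho⟩ := h
  rcases List.eq_nil_or_concat v with rfl | ⟨v', y, rfl⟩
  · have := List.append_inj' h rfl
    right
    refine ⟨by rw [← ho, this.1], ?_⟩
    have := this.2; simp at this; exact this.symm
  · left
    rw [show u ++ e :: (v'.concat y) = (u ++ e :: v') ++ [y] by simp] at h
    have := List.append_inj' h rfl
    exact ⟨u, v', this.1, ho⟩

theorem Pred.uniq {l : List E} (hl : l.Nodup) {o o' : Option E} {e : E} (h : Pred l o e)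
    (h' : Pred l o' e) : o = o' := by
  obtain ⟨u, v, rfl, rfl⟩ := h
  obtain ⟨u', v', h, rfl⟩ := h'
  rw [List.append_eq_append_iff] at h
  rcases h with ⟨a', rfl, h2⟩ | ⟨c', rfl, h2⟩
  · cases a' with
    | nil => simp
    | cons x a' =>
      simp only [List.cons_append, List.cons.injEq] at h2
      obtain ⟨rfl, rfl⟩ := h2
      have := (List.nodup_cons.1 (hl.sublist (List.sublist_append_right _ _))).1
      simp at this
  · cases c' with
    | nil => simp
    | cons x c' =>
      simp only [List.cons_append, List.cons.injEq] at h2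
      obtain ⟨rfl, rfl⟩ := h2
      rw [List.append_assoc] at hl
      have := (List.nodup_cons.1 (hl.sublist (List.sublist_append_right _ _))).1
      simp at this

variable (r : E → ℕ) (c : Fin 6 → List E)

def pre (t : ℕ) (l : List E) : List E := l.filter (fun e => decide (r e < t))
def suf (t : ℕ) (l : List E) : List E := l.filter (fun e => decide (t ≤ r e))

theorem pre_suf {l : List E} (hl : l.Pairwise (fun x y => r x < r y)) (t : ℕ) :
    pre r t l ++ suf r t l = l := by
  induction l with
  | nil => rfl
  | cons x l ih =>
    rw [List.pairwise_cons] at hl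
    by_cases hx : r x < t
    · have : ¬ t ≤ r x := by omega
      simp only [pre, suf, List.filter_cons, hx, this, decide_true, decide_false, if_true] at ih ⊢
      simpa using ih hl.2
    · have h1 : t ≤ r x := by omega
      have h2 : pre r t l = [] := by
        simp only [pre, List.filter_eq_nil_iff]
        intro y hy
        have := hl.1 y hy
        simp; omega
      have h3 : suf r t l = l := by
        simp only [suf, List.filter_eq_self]
        intro y hy
        have := hl.1 y hy
        simp; omega
      have h4 : pre r t (x :: l) = pre r t l := by simp [pre, hx]
      have h5 : suf r t (x :: l) = x :: suf r t l := by simp [suf, h1]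
      rw [h4, h5, h2, h3]; rfl

theorem pre_succ_not {l : List E} {t : ℕ} (h : ∀ e ∈ l, r e ≠ t) :
    pre r (t + 1) l = pre r t l := by
  apply List.filter_congr
  intro e he
  have := h e he
  simp only [decide_eq_decide]; omega

theorem suf_mem {l : List E} (hr : Function.Injective r)
    (hl : l.Pairwise (fun x y => r x < r y)) {e : E} (he : e ∈ l) :
    suf r (r e) l = e :: suf r (r e + 1) l ∧ pre r (r e + 1) l = pre r (r e) l ++ [e] := by
  induction l with
  | nil => simp at he
  | cons x l ih =>
    rw [List.pairwise_cons] at hl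
    rw [List.mem_cons] at he
    by_cases hx : e = x
    · subst hx
      have h1 : suf r (r e) l = suf r (r e + 1) l := by
        apply List.filter_congr
        intro y hy
        have := hl.1 y hy
        simp only [decide_eq_decide]; omega
      have h2 : ∀ t, t ≤ r e + 1 → pre r t l = [] := by
        intro t ht
        simp only [pre, List.filter_eq_nil_iff]
        intro y hy
        have := hl.1 y hy
        simp; omega
      constructor
      · have : suf r (r e + 1) (e :: l) = suf r (r e + 1) l := by simp [suf]
        rw [this, ← h1]
        simp [suf]
      · have a1 : pre r (r e + 1) (e :: l) = e :: pre r (r e + 1) l := by simp [pre]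
        have a2 : pre r (r e) (e :: l) = pre r (r e) l := by simp [pre]
        rw [a1, a2, h2 _ le_rfl, h2 _ (Nat.le_succ _)]; rfl
    · have he := he.resolve_left hx
      have hlt := hl.1 e he
      obtain ⟨i1, i2⟩ := ih hl.2 he
      constructor
      · have a1 : suf r (r e) (x :: l) = suf r (r e) l := by
          simp [suf, hlt]
        have a2 : suf r (r e + 1) (x :: l) = suf r (r e + 1) l := by
          simp [suf, show ¬ (r e < r x) by omega]
        rw [a1, a2, i1]
      · have a1 : pre r (r e) (x :: l) = x :: pre r (r e) l := by simp [pre, hlt]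
        have a2 : pre r (r e + 1) (x :: l) = x :: pre r (r e + 1) l := by
          simp [pre, show r x ≤ r e by omega]
        rw [a1, a2, i2]; rfl

def Val (I : Fin 6 → Prop) (p : List E) : Prop :=
  ∀ o e, Pred p o e → ∃ l, Pred (c l) o e ∧ (o = none → I l)

structure Sys (I : Fin 6 → Prop) (t : ℕ) (σ : Fin 3 → Fin 6) (p : Fin 3 → List E) : Prop where
  val : ∀ k, Val c I (p k)
  lt : ∀ k, ∀ e ∈ p k, r e < t
  disj : ∀ k k', k ≠ k' → ∀ e ∈ p k, e ∉ p k'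
  last : ∀ k, (p k).getLast? = (pre r t (c (σ k))).getLast?
  start : ∀ k, p k = [] → I (σ k)

/-- Standing hypotheses on the six paths. -/
structure Good : Prop where
  inj : Function.Injective r
  sorted : ∀ l, (c l).Pairwise (fun x y => r x < r y)
  disj : ∀ l l' : Fin 6, (l.val < 3 ↔ l'.val < 3) → l ≠ l' → ∀ e ∈ c l, e ∉ c l'

variable {r c}

theorem Good.pred (hG : Good r c) {l : Fin 6} {e : E} (he : e ∈ c l) :
    Pred (c l) (pre r (r e) (c l)).getLast? e := by
  refine ⟨pre r (r e) (c l), suf r (r e + 1) (c l), ?_, rfl⟩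
  rw [← (suf_mem r hG.inj (hG.sorted l) he).1, pre_suf r (hG.sorted l)]

theorem ext (hG : Good r c) {I : Fin 6 → Prop} {σ σ' : Fin 3 → Fin 6} {p : Fin 3 → List E} {e : E}
    (hp : Sys r c I (r e) σ p)
    (hσ : ∀ k, (e ∈ c (σ k) ∧ e ∈ c (σ' k)) ∨ (σ' k = σ k ∧ e ∉ c (σ k)))
    (hu : ∀ k k', e ∈ c (σ k) → e ∈ c (σ k') → k = k') :
    ∃ p', Sys r c I (r e + 1) σ' p' ∧ ∀ k, e ∈ c (σ k) → p' k = p k ++ [e] := by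
  classical
  refine ⟨fun k => if e ∈ c (σ k) then p k ++ [e] else p k, ⟨?_, ?_, ?_, ?_, ?_⟩, ?_⟩
  · intro k
    beta_reduce
    split_ifs with h
    · intro o x hx
      rcases pred_snoc hx with hx | ⟨rfl, rfl⟩
      · exact hp.val k o x hx
      · refine ⟨σ k, ?_, ?_⟩
        · rw [hp.last]; exact hG.pred h
        · intro hn
          exact hp.start k (List.getLast?_eq_none_iff.1 hn)
    · exact hp.val k
  · intro k x hx
    beta_reduce at hx
    split_ifs at hx with h
    · rw [List.mem_append, List.mem_singleton] at hx
      rcases hx with hx | rfl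
      · have := hp.lt k x hx; omega
      · omega
    · have := hp.lt k x hx; omega
  · intro k k' hk x hx hx'
    beta_reduce at hx hx'
    split_ifs at hx hx' with h h' h'
    · exact hk (hu _ _ h h')
    · rw [List.mem_append, List.mem_singleton] at hx
      rcases hx with hx | rfl
      · exact hp.disj k k' hk x hx hx'
      · have := hp.lt k' x hx'; omega
    · rw [List.mem_append, List.mem_singleton] at hx'
      rcases hx' with hx' | rfl
      · exact hp.disj k k' hk x hx hx'
      · have := hp.lt k x hx; omega
    · exact hp.disj k k' hk x hx hx'
  · intro k
    beta_reduce
    rcases hσ k with ⟨h, h'⟩ | ⟨h, h'⟩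
    · rw [if_pos h, (suf_mem r hG.inj (hG.sorted _) h').2]; simp
    · rw [if_neg h', h, hp.last, pre_succ_not]
      intro x hx hxe
      rw [hG.inj hxe] at hx
      exact h' hx
  · intro k hk
    beta_reduce at hk
    rcases hσ k with ⟨h, h'⟩ | ⟨h, h'⟩
    · rw [if_pos h] at hk; simp at hk
    · rw [if_neg h'] at hk; rw [h]; exact hp.start k hk
  · intro k hk
    exact if_pos hk

theorem finish (hG : Good r c) {I : Fin 6 → Prop} {ι : Fin 3 → Fin 6} {p : Fin 3 → List E} {t : ℕ}
    (hι : Function.Injective ι) (hI : ∀ k, I (ι k)) (hI' : ∀ k k', (ι k).val < 3 ↔ (ι k').val < 3)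
    (hp : Sys r c I t ι p) :
    ∃ q : Fin 3 → List E, (∀ k, Val c I (q k)) ∧ (∀ k k', k ≠ k' → ∀ e ∈ q k, e ∉ q k') ∧
      (∀ k, (q k).getLast? = (c (ι k)).getLast?) ∧ ∀ k o e, Pred (p k) o e → Pred (q k) o e := by
  refine ⟨fun k => p k ++ suf r t (c (ι k)), ?_, ?_, ?_, ?_⟩
  · intro k o e h
    rcases pred_append (hp.last k) h with h | h
    · exact hp.val k o e h
    · rw [pre_suf r (hG.sorted _)] at h
      exact ⟨_, h, fun _ => hI k⟩
  · intro k k' hk e he he'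
    rw [List.mem_append] at he he'
    have hs : ∀ k, e ∈ suf r t (c (ι k)) → t ≤ r e ∧ e ∈ c (ι k) := by
      intro k h
      simp only [suf, List.mem_filter, decide_eq_true_eq] at h
      exact ⟨h.2, h.1⟩
    rcases he with he | he <;> rcases he' with he' | he'
    · exact hp.disj k k' hk e he he'
    · have := hp.lt _ _ he; have := (hs _ he').1; omega
    · have := hp.lt _ _ he'; have := (hs _ he).1; omega
    · exact hG.disj (ι k) (ι k') (hI' k k') (fun h => hk (hι h)) e (hs _ he).2 (hs _ he').2
  · intro k
    conv_rhs => rw [← pre_suf r (hG.sorted (ι k)) t]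
    simp [List.getLast?_append, hp.last k]
  · intro k o e h
    exact h.append _

/-- `e` is an (extended) merging of the two groups. -/
def Ev (c : Fin 6 → List E) (i j : Fin 3) (e : E) : Prop :=
  e ∈ c (lf i) ∧ e ∈ c (rg j) ∧ ¬ ∃ f, Pred (c (lf i)) (some f) e ∧ Pred (c (rg j)) (some f) e

/-- A profitable rerouting of the group `ι` (with label set `I`). -/
def Reroute (c : Fin 6 → List E) (I : Fin 6 → Prop) (ι : Fin 3 → Fin 6) : Prop :=
  ∃ q : Fin 3 → List E, (∀ k, Val c I (q k)) ∧ (∀ k k', k ≠ k' → ∀ e ∈ q k, e ∉ q k') ∧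
    (∀ k, (q k).getLast? = (c (ι k)).getLast?) ∧
    ∃ i j e, Ev c i j e ∧ ∃ k f g, ¬ I g ∧ Pred (q k) (some f) e ∧ Pred (c g) (some f) e

def Inv (r : E → ℕ) (c : Fin 6 → List E) (I : Fin 6 → Prop) (F t : ℕ) : Prop :=
  ∀ σ : Fin 3 → Fin 6, Function.Injective σ → tb F (code σ) = true → ∃ p, Sys r c I t σ p

theorem win (hG : Good r c) {I : Fin 6 → Prop} {ι : Fin 3 → Fin 6} {F : ℕ}
    (hι : Function.Injective ι) (hI : ∀ k, I (ι k)) (hI' : ∀ k k', (ι k).val < 3 ↔ (ι k').val < 3)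
    {i j : Fin 3} {e : E} (hev : Ev c i j e) (hF : Inv r c I F (r e))
    {i0 : Fin 3} {g : Fin 6} (hg : ¬ I g) (he0 : e ∈ c (ι i0)) (heg : e ∈ c g)
    (hb : tb F (code (repl ι i0 g)) = true) : Reroute c I ι := by
  have hgι : ∀ k, ι k ≠ g := fun k h => hg (h ▸ hI k)
  obtain ⟨p, hp⟩ := hF _ (repl_inj hι i0 g hgι) hb
  have hne : ∀ k, k ≠ i0 → e ∉ c (ι k) := by
    intro k hk h
    exact hG.disj (ι k) (ι i0) (hI' _ _) (fun h => hk (hι h)) e h he0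
  have hr0 : repl ι i0 g i0 = g := by simp [repl]
  have hr1 : ∀ k, k ≠ i0 → repl ι i0 g k = ι k := fun k hk => by simp [repl, hk]
  obtain ⟨p', hp', hpe⟩ := ext (σ' := ι) hG hp (by
      intro k
      by_cases hk : k = i0
      · subst hk; rw [hr0]; exact Or.inl ⟨heg, he0⟩
      · rw [hr1 k hk]; exact Or.inr ⟨rfl, hne k hk⟩) (by
      have : ∀ k, e ∈ c (repl ι i0 g k) → k = i0 := by
        intro k h
        by_contra hk
        rw [hr1 k hk] at h
        exact hne k hk h
      intro k k' h h'
      rw [this k h, this k' h'])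
  obtain ⟨q, h1, h2, h3, h4⟩ := finish hG hι hI hI' hp'
  refine ⟨q, h1, h2, h3, i, j, e, hev, ?_⟩
  have hpp : Pred (q i0) (p i0).getLast? e := by
    apply h4
    rw [hpe i0 (by rw [hr0]; exact heg)]
    exact ⟨p i0, [], rfl, rfl⟩
  have hpn : p i0 ≠ [] := by
    intro h
    have := hp.start i0 h
    rw [hr0] at this
    exact hg this
  have hl := hp.last i0
  rw [hr0] at hl
  have hgp := hG.pred heg
  rw [← hl] at hgp
  cases ho : (p i0).getLast? with
  | none => exact (hpn (List.getLast?_eq_none_iff.1 ho)).elim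
  | some f =>
    rw [ho] at hpp hgp
    exact ⟨i0, f, g, hg, hpp, hgp⟩

theorem label_cases (l : Fin 6) : (∃ i, l = lf i) ∨ ∃ j, l = rg j := by
  revert l; decide

theorem inv_quiet (hG : Good r c) {I : Fin 6 → Prop} {F t : ℕ} (hF : Inv r c I F t)
    (hq : ∀ e, r e = t → ∀ i j, ¬ Ev c i j e) : Inv r c I F (t + 1) := by
  intro σ hσ hb
  obtain ⟨p, hp⟩ := hF σ hσ hb
  by_cases he : ∃ e, r e = t
  · obtain ⟨e, rfl⟩ := he
    have key : ∀ k k' i j, σ k = lf i → σ k' = rg j → e ∈ c (lf i) → e ∈ c (rg j) → False := by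
      intro k k' i j hk hk' h1 h2
      have hne := hq e rfl i j
      have : ∃ f, Pred (c (lf i)) (some f) e ∧ Pred (c (rg j)) (some f) e := by
        by_contra h; exact hne ⟨h1, h2, h⟩
      obtain ⟨f, hf1, hf2⟩ := this
      have nd : ∀ l, (c l).Nodup := fun l =>
        (hG.sorted l).imp (fun h h' => by rw [h'] at h; exact lt_irrefl _ h)
      have e1 := hf1.uniq (nd _) (hG.pred h1)
      have e2 := hf2.uniq (nd _) (hG.pred h2)
      have l1 := hp.last k
      have l2 := hp.last k'
      rw [hk, ← e1] at l1
      rw [hk', ← e2] at l2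
      have m1 := List.mem_of_getLast? l1
      have m2 := List.mem_of_getLast? l2
      refine hp.disj k k' ?_ f m1 m2
      rintro rfl
      rw [hk] at hk'
      revert hk'; clear * -; revert i j; decide
    obtain ⟨p', hp', -⟩ := ext (σ' := σ) hG hp (by
      intro k
      by_cases h : e ∈ c (σ k)
      · exact Or.inl ⟨h, h⟩
      · exact Or.inr ⟨rfl, h⟩) (by
      intro k k' h h'
      by_contra hk
      have hs : σ k ≠ σ k' := fun h => hk (hσ h)
      rcases label_cases (σ k) with ⟨i, hi⟩ | ⟨i, hi⟩ <;>
        rcases label_cases (σ k') with ⟨j, hj⟩ | ⟨j, hj⟩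
      · refine hG.disj _ _ ?_ hs e h h'
        rw [hi, hj]; simp [lf]
      · rw [hi] at h; rw [hj] at h'
        exact key k k' i j hi hj h h'
      · rw [hi] at h; rw [hj] at h'
        exact key k' k j i hj hi h' h
      · refine hG.disj _ _ ?_ hs e h h'
        rw [hi, hj]; simp [rg])
    exact ⟨p', hp'⟩
  · refine ⟨p, hp.val, fun k e h => (hp.lt k e h).trans (Nat.lt_succ_self _), hp.disj, ?_, hp.start⟩
    intro k
    rw [hp.last, pre_succ_not]
    intro e _ h
    exact he ⟨e, h⟩

theorem mem_iff (hG : Good r c) {i j : Fin 3} {e : E} (h1 : e ∈ c (lf i)) (h2 : e ∈ c (rg j))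
    (l : Fin 6) : e ∈ c l ↔ (l = lf i ∨ l = rg j) := by
  constructor
  · intro h
    rcases label_cases l with ⟨i', rfl⟩ | ⟨j', rfl⟩
    · left; by_contra hne
      exact hG.disj _ _ (by simp [lf]) hne e h h1
    · right; by_contra hne
      exact hG.disj _ _ (by simp [rg]) hne e h h2
  · rintro (rfl | rfl) <;> assumption

theorem inv_event (hG : Good r c) {I : Fin 6 → Prop} {F : ℕ} {i j : Fin 3} {e : E}
    (hF : Inv r c I F (r e)) (hev : Ev c i j e) :
    Inv r c I (stepF F i (3 + j)) (r e + 1) := by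
  intro σ' hσ' hb
  obtain ⟨σ, h1, h2, h3, h4⟩ := step_spec F i j σ' hσ' hb
  obtain ⟨p, hp⟩ := hF σ h1 h2
  have hm := mem_iff hG hev.1 hev.2.1
  obtain ⟨p', hp', -⟩ := ext (σ' := σ') hG hp (by
    intro k
    rw [hm, hm]; exact h3 k) (by
    intro k k'
    rw [hm, hm]; exact h4 k k')
  exact ⟨p', hp'⟩

theorem inv_init {I : Fin 6 → Prop} {F : ℕ}
    (h : ∀ σ : Fin 3 → Fin 6, Function.Injective σ → tb F (code σ) = true → ∀ k, I (σ k)) :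
    Inv r c I F 0 := by
  intro σ hσ hb
  refine ⟨fun _ => [], ?_, ?_, ?_, ?_, ?_⟩
  · rintro k o e ⟨u, v, h, -⟩
    simp at h
  · intro k e h; simp at h
  · intro k k' _ e h; simp at h
  · intro k; simp [pre]
  · intro k _; exact h σ hσ hb k

def IA (l : Fin 6) : Prop := l.val < 3
def IB (l : Fin 6) : Prop := ¬ l.val < 3

theorem run_ok (hG : Good r c) (hA : ¬ Reroute c IA lf) (hB : ¬ Reroute c IB rg)
    (ev : ℕ → Option Ltr) (h1 : ∀ t x, ev t = some x → ∃ e, r e = t ∧ Ev c x.1 x.2 e)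
    (h2 : ∀ t, ev t = none → ∀ e, r e = t → ∀ i j, ¬ Ev c i j e) (t : ℕ) :
    ∃ F G, run ((List.range t).filterMap ev) = some (F, G) ∧ Inv r c IA F t ∧ Inv r c IB G t := by
  induction t with
  | zero =>
    refine ⟨2 ^ 7, 2 ^ 56, rfl, inv_init ?_, inv_init ?_⟩ <;> intro σ hσ hb k
    · have := init1 _ _ _ hb (fun h => absurd (hσ h) (by decide))
        (fun h => absurd (hσ h) (by decide)) (fun h => absurd (hσ h) (by decide))
      fin_cases k
      · exact this.1
      · exact this.2.1
      · exact this.2.2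
    · have := init2 _ _ _ hb (fun h => absurd (hσ h) (by decide))
        (fun h => absurd (hσ h) (by decide)) (fun h => absurd (hσ h) (by decide))
      fin_cases k
      · exact this.1
      · exact this.2.1
      · exact this.2.2
  | succ t ih =>
    obtain ⟨F, G, hr, hF, hGG⟩ := ih
    rw [List.range_succ, List.filterMap_append]
    cases he : ev t with
    | none =>
      refine ⟨F, G, ?_, inv_quiet hG hF (h2 t he), inv_quiet hG hGG (h2 t he)⟩
      simpa [he] using hr
    | some x =>
      obtain ⟨e, rfl, hev⟩ := h1 t x he
      obtain ⟨i, j⟩ := x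
      have hnb : bad F G i j = false := by
        by_contra hb
        rw [Bool.not_eq_false] at hb
        unfold bad at hb
        rw [Bool.or_eq_true, cA_eq, cB_eq] at hb
        rcases hb with hb | hb
        · refine hA (win hG lf_inj ?_ ?_ hev hF (i0 := i) (g := rg j) ?_ hev.1 hev.2.1 hb)
          · intro k; exact k.2
          · intro k k'; simp [lf]
          · simp [IA, rg]
        · refine hB (win hG rg_inj ?_ ?_ hev hGG (i0 := j) (g := lf i) ?_ hev.2.1 hev.1 hb)
          · intro k; simp [IB, rg]
          · intro k k'; simp [rg]
          · simp [IB, lf]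
      refine ⟨stepF F i (3 + j), stepF G i (3 + j), ?_, inv_event hG hF hev, inv_event hG hGG hev⟩
      have : List.filterMap ev [r e] = [(i, j)] := by simp [he]
      rw [this, run, List.foldl_append]
      change stp (run _) (i, j) = _
      rw [hr]
      simp [stp, hnb]

end Link

end M33

namespace M33

open MultiDigraph

section Graph

variable {E : Type}

def lab (a b : Fin 3 → List E) (l : Fin 6) : List E :=
  if h : l.val < 3 then a ⟨l.val, h⟩ else b ⟨l.val - 3, by omega⟩

theorem lab_lf (a b : Fin 3 → List E) (i : Fin 3) : lab a b (lf i) = a i := by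
  simp [lab, lf]

theorem lab_rg (a b : Fin 3 → List E) (j : Fin 3) : lab a b (rg j) = b j := by
  simp [lab, rg]

def Mrg (a b : Fin 3 → List E) : Set E :=
  {e | (∃ i, e ∈ a i) ∧ (∃ j, e ∈ b j) ∧
    ¬ ∃ f, (∃ i, Pred (a i) (some f) e) ∧ ∃ j, Pred (b j) (some f) e}

theorem Mrg_symm (a b : Fin 3 → List E) : Mrg a b = Mrg b a := by
  ext e
  simp only [Mrg, Set.mem_setOf_eq]
  constructor <;> rintro ⟨h1, h2, h3⟩ <;> exact ⟨h2, h1, fun ⟨f, x, y⟩ => h3 ⟨f, y, x⟩⟩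

theorem Mrg_perm (a b : Fin 3 → List E) (π σ : Equiv.Perm (Fin 3)) :
    Mrg (fun i => a (π i)) (fun j => b (σ j)) = Mrg a b := by
  ext e
  simp only [Mrg, Set.mem_setOf_eq, ← π.surjective.exists (p := fun i => e ∈ a i),
    ← σ.surjective.exists (p := fun i => e ∈ b i),
    ← fun f => π.surjective.exists (p := fun i => Pred (a i) (some f) e),
    ← fun f => σ.surjective.exists (p := fun i => Pred (b i) (some f) e)]

theorem dec {a b q : Fin 3 → List E} (hd : ∀ i j, i ≠ j → ∀ e, e ∈ a i → e ∉ a j)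
    (hn : ∀ i, (a i).Nodup)
    (hv : ∀ k o e, Pred (q k) o e →
      (∃ i, Pred (a i) o e) ∨ ∃ f, o = some f ∧ ∃ j, Pred (b j) (some f) e)
    {e0 f : E} {k j : Fin 3} (he : e0 ∈ Mrg a b) (h1 : Pred (q k) (some f) e0)
    (h2 : Pred (b j) (some f) e0) : Mrg q b ⊂ Mrg a b := by
  rw [Set.ssubset_iff_of_subset]
  · exact ⟨e0, he, fun h => h.2.2 ⟨f, ⟨k, h1⟩, ⟨j, h2⟩⟩⟩
  · rintro e ⟨⟨k, hk⟩, hj, h⟩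
    obtain ⟨o, ho⟩ := exists_pred hk
    rcases hv k o e ho with ⟨i, hi⟩ | ⟨f, rfl, j, hj'⟩
    · refine ⟨⟨i, hi.mem⟩, hj, ?_⟩
      rintro ⟨f, ⟨i', hi'⟩, hb⟩
      have : i = i' := by
        by_contra hne
        exact hd i i' hne e hi.mem hi'.mem
      subst this
      have := hi.uniq (hn i) hi'
      subst this
      exact h ⟨f, ⟨k, ho⟩, hb⟩
    · exact (h ⟨f, ⟨k, ho⟩, ⟨j, hj'⟩⟩).elim

theorem chain_iff_pred {R : E → E → Prop} {l : List E} :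
    l.IsChain R ↔ ∀ f e, Pred l (some f) e → R f e := by
  rw [List.isChain_iff_forall_rel_of_append_cons_cons]
  constructor
  · rintro h f e ⟨u, v, rfl, hu⟩
    rw [List.getLast?_eq_some_iff] at hu
    obtain ⟨u', rfl⟩ := hu
    exact h (l₁ := u') (l₂ := v) (by simp)
  · intro h f e u v hl
    exact h f e ⟨u ++ [f], v, by simp [hl], by simp⟩

theorem head_pred {l : List E} {e : E} : e ∈ l.head? ↔ Pred l none e := by
  cases l with
  | nil =>
    simp only [List.head?_nil, Option.mem_def, reduceCtorEq, false_iff]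
    rintro ⟨u, v, h, -⟩
    simp at h
  | cons x l =>
    simp only [List.head?_cons, Option.mem_def, Option.some.injEq]
    constructor
    · rintro rfl
      exact ⟨[], l, rfl, rfl⟩
    · rintro ⟨u, v, h, hu⟩
      rw [List.getLast?_eq_none_iff] at hu
      subst hu
      simp at h
      exact h.1

theorem path_of_val {G : MultiDigraph} {c : Fin 6 → List G.E} {I : Fin 6 → Prop} {u v : G.V}
    (hI : ∀ l, I l → G.IsPathFrom u v (c l)) (hc : ∀ l, ∃ u v, G.IsPathFrom u v (c l))
    {q : List G.E} (hq : Val c I q) {l : Fin 6} (hl : I l) (hlast : q.getLast? = (c l).getLast?) :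
    G.IsPathFrom u v q := by
  refine ⟨?_, ?_, ?_, ?_⟩
  · rintro rfl
    have := (hI l hl).1
    apply this
    rw [← List.getLast?_eq_none_iff, ← hlast]; rfl
  · refine chain_iff_pred.2 ?_
    intro f e h
    obtain ⟨l', h', -⟩ := hq _ _ h
    obtain ⟨u', v', hp⟩ := hc l'
    exact chain_iff_pred.1 hp.2.1 f e h'
  · intro e he
    obtain ⟨l', h', h''⟩ := hq _ _ (head_pred.1 he)
    exact (hI l' (h'' rfl)).2.2.1 e (head_pred.2 h')
  · rw [hlast]; exact (hI l hl).2.2.2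

theorem sorted_of_path {G : MultiDigraph} {r : G.E → ℕ}
    (hr : ∀ f e, G.dst f = G.src e → r f < r e) {u v : G.V} {p : List G.E}
    (hp : G.IsPathFrom u v p) : p.Pairwise (fun x y => r x < r y) := by
  have hch : p.IsChain (fun x y => r x < r y) := List.IsChain.imp (fun a b h => hr a b h) hp.2.1
  haveI : IsTrans G.E (fun x y => r x < r y) := ⟨fun a b c h h' => lt_trans h h'⟩
  exact List.isChain_iff_pairwise.1 hch

theorem nodup_of_sorted {r : E → ℕ} {p : List E} (h : p.Pairwise (fun x y => r x < r y)) :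
    p.Nodup := h.imp (fun h h' => by rw [h'] at h; exact lt_irrefl _ h)

theorem exists_rank (G : MultiDigraph) (hG : G.Acyclic) :
    ∃ r : G.E → ℕ, Function.Injective r ∧ (∀ f e, G.dst f = G.src e → r f < r e) ∧
      ∃ n, ∀ e, r e < n := by
  classical
  haveI := G.fintE
  let R : G.E → G.E → Prop := fun f e => G.dst f = G.src e
  have hpath : ∀ f e, Relation.TransGen R f e →
      ∃ p, G.IsPathFrom (G.src f) (G.src e) p := by
    intro f e h
    induction h with
    | single h => 
      refine ⟨[f], by simp, List.isChain_singleton _, by simp, ?_⟩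
      intro x hx; simp at hx; subst hx; exact h
    | @tail b d h1 h2 ih =>
      obtain ⟨p, hp⟩ := ih
      refine ⟨p ++ [b], by simp, ?_, ?_, ?_⟩
      · refine List.IsChain.append hp.2.1 (by simp) ?_
        intro x hx y hy
        simp at hy; subst hy
        exact hp.2.2.2 x hx
      · intro x hx
        rw [List.head?_append_of_ne_nil _ hp.1] at hx
        exact hp.2.2.1 x hx
      · intro x hx; simp at hx; subst hx; exact h2
  have hirr : ∀ e, ¬ Relation.TransGen R e e := by
    intro e h
    obtain ⟨p, hp⟩ := hpath e e h
    exact hG _ _ hp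
  let d : G.E → ℕ := fun e => (Finset.univ.filter fun f => Relation.TransGen R f e).card
  have hd : ∀ f e, R f e → d f < d e := by
    intro f e h
    apply Finset.card_lt_card
    rw [Finset.ssubset_iff_of_subset]
    · refine ⟨f, by simpa using Relation.TransGen.single h, by simpa using hirr f⟩
    · intro x hx
      simp only [Finset.mem_filter, Finset.mem_univ, true_and] at hx ⊢
      exact hx.tail h
  let N := Fintype.card G.E
  let idx := Fintype.equivFin G.E
  have key : ∀ f e, d f < d e → d f * N + idx f < d e * N + idx e := by
    intro f e h
    have h1 : (d f + 1) * N ≤ d e * N := Nat.mul_le_mul_right _ h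
    have h2 := (idx f).2
    rw [add_mul, one_mul] at h1
    omega
  refine ⟨fun e => d e * N + idx e, ?_, ?_, ?_⟩
  · intro f e h
    simp only at h
    rcases lt_trichotomy (d f) (d e) with h' | h' | h'
    · have := key _ _ h'; omega
    · rw [h'] at h
      have : (idx f).val = (idx e).val := by omega
      exact idx.injective (Fin.ext this)
    · have := key _ _ h'; omega
  · intro f e h
    exact key f e (hd f e h)
  · obtain ⟨n, hn⟩ := Finset.exists_nat_subset_range (Finset.univ.image fun e => d e * N + (idx e).val)
    refine ⟨n, fun e => ?_⟩
    have := hn (Finset.mem_image_of_mem (fun e => d e * N + (idx e).val) (Finset.mem_univ e))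
    simpa using this

variable {G : MultiDigraph} {r : G.E → ℕ} {u1 v1 u2 v2 : G.V}

def Minl (G : MultiDigraph) (u1 v1 u2 v2 : G.V) (a b : Fin 3 → List G.E) : Prop :=
  G.MengerSystem u1 v1 3 a ∧ G.MengerSystem u2 v2 3 b ∧
    ∀ a' b', G.MengerSystem u1 v1 3 a' → G.MengerSystem u2 v2 3 b' →
      (Mrg a b).ncard ≤ (Mrg a' b').ncard

theorem good_lab (hinj : Function.Injective r) (hr : ∀ f e, G.dst f = G.src e → r f < r e)
    {a b : Fin 3 → List G.E} (ha : G.MengerSystem u1 v1 3 a) (hb : G.MengerSystem u2 v2 3 b) :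
    Good r (lab a b) := by
  refine ⟨hinj, ?_, ?_⟩
  · intro l
    rcases label_cases l with ⟨i, rfl⟩ | ⟨i, rfl⟩
    · rw [lab_lf]; exact sorted_of_path hr (ha.1 i)
    · rw [lab_rg]; exact sorted_of_path hr (hb.1 i)
  · intro l l' h hne
    rcases label_cases l with ⟨i, rfl⟩ | ⟨i, rfl⟩ <;>
      rcases label_cases l' with ⟨j, rfl⟩ | ⟨j, rfl⟩
    · rw [lab_lf, lab_lf]
      exact ha.2 i j (fun h => hne (by rw [h]))
    · simp [lf, rg] at h
    · simp [lf, rg] at h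
    · rw [lab_rg, lab_rg]
      exact hb.2 i j (fun h => hne (by rw [h]))

theorem ev_mrg {a b : Fin 3 → List G.E} (ha : G.MengerSystem u1 v1 3 a)
    (hb : G.MengerSystem u2 v2 3 b) {i j : Fin 3} {e : G.E} (h : Ev (lab a b) i j e) :
    e ∈ Mrg a b := by
  obtain ⟨h1, h2, h3⟩ := h
  rw [lab_lf] at h1 h3
  rw [lab_rg] at h2 h3
  refine ⟨⟨i, h1⟩, ⟨j, h2⟩, ?_⟩
  rintro ⟨f, ⟨i', hi⟩, ⟨j', hj⟩⟩
  have e1 : i = i' := by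
    by_contra hne; exact ha.2 i i' hne e h1 hi.mem
  have e2 : j = j' := by
    by_contra hne; exact hb.2 j j' hne e h2 hj.mem
  subst e1 e2
  exact h3 ⟨f, hi, hj⟩

theorem lab_path {a b : Fin 3 → List G.E} (ha : G.MengerSystem u1 v1 3 a)
    (hb : G.MengerSystem u2 v2 3 b) (l : Fin 6) : ∃ u v, G.IsPathFrom u v (lab a b l) := by
  rcases label_cases l with ⟨i, rfl⟩ | ⟨i, rfl⟩
  · rw [lab_lf]; exact ⟨_, _, ha.1 i⟩
  · rw [lab_rg]; exact ⟨_, _, hb.1 i⟩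

theorem noA (hr : ∀ f e, G.dst f = G.src e → r f < r e)
    {a b : Fin 3 → List G.E} (h : Minl G u1 v1 u2 v2 a b) : ¬ Reroute (lab a b) IA lf := by
  obtain ⟨ha, hb, hmin⟩ := h
  rintro ⟨q, h1, h2, h3, i, j, e, hev, k, f, g, hg, hp1, hp2⟩
  have hI : ∀ l, IA l → G.IsPathFrom u1 v1 (lab a b l) := by
    intro l hl
    rcases label_cases l with ⟨i, rfl⟩ | ⟨i, rfl⟩
    · rw [lab_lf]; exact ha.1 i
    · simp [IA, rg] at hl
  have hq : G.MengerSystem u1 v1 3 q :=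
    ⟨fun k => path_of_val hI (lab_path ha hb) (h1 k) (l := lf k) (by simp [IA, lf]) (h3 k),
      fun i j hij e he => h2 i j hij e he⟩
  have hle := hmin q b hq hb
  obtain ⟨j', hj'⟩ : ∃ j', g = rg j' := by
    rcases label_cases g with ⟨i, rfl⟩ | h
    · simp [IA, lf] at hg
    · exact h
  subst hj'
  rw [lab_rg] at hp2
  have hlt : Mrg q b ⊂ Mrg a b := by
    refine dec ha.2 (fun i => nodup_of_sorted (sorted_of_path hr (ha.1 i))) ?_ (ev_mrg ha hb hev)
      hp1 hp2
    intro k o e ho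
    obtain ⟨l, hl, hl'⟩ := h1 k o e ho
    rcases label_cases l with ⟨i, rfl⟩ | ⟨i, rfl⟩
    · rw [lab_lf] at hl; exact Or.inl ⟨i, hl⟩
    · right
      cases o with
      | none => have := hl' rfl; simp [IA, rg] at this
      | some f => rw [lab_rg] at hl; exact ⟨f, rfl, i, hl⟩
  haveI := G.fintE
  have := Set.ncard_lt_ncard hlt (Set.toFinite _)
  omega

theorem noB (hr : ∀ f e, G.dst f = G.src e → r f < r e)
    {a b : Fin 3 → List G.E} (h : Minl G u1 v1 u2 v2 a b) : ¬ Reroute (lab a b) IB rg := by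
  obtain ⟨ha, hb, hmin⟩ := h
  rintro ⟨q, h1, h2, h3, i, j, e, hev, k, f, g, hg, hp1, hp2⟩
  have hI : ∀ l, IB l → G.IsPathFrom u2 v2 (lab a b l) := by
    intro l hl
    rcases label_cases l with ⟨i, rfl⟩ | ⟨i, rfl⟩
    · simp [IB, lf] at hl
    · rw [lab_rg]; exact hb.1 i
  have hq : G.MengerSystem u2 v2 3 q :=
    ⟨fun k => path_of_val hI (lab_path ha hb) (h1 k) (l := rg k) (by simp [IB, rg]) (h3 k),
      fun i j hij e he => h2 i j hij e he⟩
  have hle := hmin a q ha hq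
  obtain ⟨j', hj'⟩ : ∃ j', g = lf j' := by
    rcases label_cases g with h | ⟨i, rfl⟩
    · exact h
    · simp [IB, rg] at hg
  subst hj'
  rw [lab_lf] at hp2
  have hmem := ev_mrg ha hb hev
  rw [Mrg_symm a b] at hle hmem
  rw [Mrg_symm a q] at hle
  have hlt : Mrg q a ⊂ Mrg b a := by
    refine dec hb.2 (fun i => nodup_of_sorted (sorted_of_path hr (hb.1 i))) ?_ hmem
      hp1 hp2
    intro k o e ho
    obtain ⟨l, hl, hl'⟩ := h1 k o e ho
    rcases label_cases l with ⟨i, rfl⟩ | ⟨i, rfl⟩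
    · right
      cases o with
      | none => have := hl' rfl; simp [IB, lf] at this
      | some f => rw [lab_lf] at hl; exact ⟨f, rfl, i, hl⟩
    · rw [lab_rg] at hl; exact Or.inl ⟨i, hl⟩
  haveI := G.fintE
  have := Set.ncard_lt_ncard hlt (Set.toFinite _)
  omega

theorem Minl.perm {a b : Fin 3 → List G.E} (h : Minl G u1 v1 u2 v2 a b)
    (π σ : Equiv.Perm (Fin 3)) :
    Minl G u1 v1 u2 v2 (fun i => a (π i)) (fun j => b (σ j)) := by
  obtain ⟨ha, hb, hmin⟩ := h
  refine ⟨⟨fun i => ha.1 _, fun i j hij => ha.2 _ _ (fun h => hij (π.injective h))⟩,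
    ⟨fun i => hb.1 _, fun i j hij => hb.2 _ _ (fun h => hij (σ.injective h))⟩, ?_⟩
  rw [Mrg_perm]; exact hmin

theorem ev_perm (a b : Fin 3 → List G.E) (π σ : Equiv.Perm (Fin 3)) (i j : Fin 3) (e : G.E) :
    Ev (lab (fun i => a (π.symm i)) (fun j => b (σ.symm j))) (π i) (σ j) e ↔ Ev (lab a b) i j e := by
  simp only [Ev, lab_lf, lab_rg, Equiv.symm_apply_apply]

theorem minl_bound (hG : G.Acyclic) {a b : Fin 3 → List G.E} (h : Minl G u1 v1 u2 v2 a b) :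
    (Mrg a b).ncard ≤ 13 := by
  classical
  obtain ⟨r, hinj, hr, n, hn⟩ := exists_rank G hG
  let ev : ℕ → Option Ltr := fun t =>
    if h : ∃ x : Ltr, ∃ e, r e = t ∧ Ev (lab a b) x.1 x.2 e then some h.choose else none
  have ev1 : ∀ t x, ev t = some x → ∃ e, r e = t ∧ Ev (lab a b) x.1 x.2 e := by
    intro t x hx
    by_cases h : ∃ x : Ltr, ∃ e, r e = t ∧ Ev (lab a b) x.1 x.2 e
    · simp only [ev, dif_pos h, Option.some.injEq] at hx
      rw [← hx]; exact h.choose_spec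
    · have h0 : ev t = none := dif_neg h
      rw [h0] at hx; cases hx
  have ev2 : ∀ t, ev t = none → ∀ e, r e = t → ∀ i j, ¬ Ev (lab a b) i j e := by
    intro t ht e he i j hev
    have h : ∃ x : Ltr, ∃ e, r e = t ∧ Ev (lab a b) x.1 x.2 e := ⟨(i, j), e, he, hev⟩
    have h0 : ev t = some h.choose := dif_pos h
    rw [h0] at ht; cases ht
  have hlen : ((List.range n).filterMap ev).length < 14 := by
    apply words_bound
    intro π σ
    have hm := h.perm π.symm σ.symm
    obtain ⟨F, G', hrun, -⟩ := run_ok (good_lab hinj hr hm.1 hm.2.1) (noA hr hm) (noB hr hm)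
      (fun t => (ev t).map fun x => (π x.1, σ x.2)) (by
        intro t x hx
        rw [Option.map_eq_some_iff] at hx
        obtain ⟨y, hy, rfl⟩ := hx
        obtain ⟨e, he, hev⟩ := ev1 t y hy
        exact ⟨e, he, (ev_perm a b π σ _ _ e).2 hev⟩) (by
        intro t ht e he i j hev
        rw [Option.map_eq_none_iff] at ht
        rw [← π.apply_symm_apply i, ← σ.apply_symm_apply j, ev_perm] at hev
        exact ev2 t ht e he _ _ hev) n
    rw [List.map_filterMap, hrun]
    simp
  have hle : (Mrg a b).ncard ≤ ((List.range n).filterMap ev).length := by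
    rw [← Set.ncard_image_of_injective _ hinj, List.length_filterMap_eq_countP,
      List.countP_eq_length_filter, ← List.toFinset_card_of_nodup (List.nodup_range.filter _),
      ← Set.ncard_coe_finset]
    apply Set.ncard_le_ncard _ (Set.toFinite _)
    rintro _ ⟨e, ⟨⟨i, hi⟩, ⟨j, hj⟩, hne⟩, rfl⟩
    simp only [List.coe_toFinset, List.mem_filter, List.mem_range, Set.mem_setOf_eq]
    refine ⟨hn e, ?_⟩
    rw [Option.isSome_iff_ne_none]
    intro hnone
    refine ev2 _ hnone e rfl i j ⟨by rwa [lab_lf], by rwa [lab_rg], ?_⟩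
    rw [lab_lf, lab_rg]
    rintro ⟨f, h1, h2⟩
    exact hne ⟨f, ⟨i, h1⟩, ⟨j, h2⟩⟩
  omega

theorem pred_of_infix {l : List E} {f e : E} (h : [f, e] <:+: l) : Pred l (some f) e := by
  obtain ⟨s, t, rfl⟩ := h
  exact ⟨s ++ [f], t, by simp, by simp⟩

theorem merging_mrg (hr : ∀ f e, G.dst f = G.src e → r f < r e)
    {a b : Fin 3 → List G.E} (ha : G.MengerSystem u1 v1 3 a) (hb : G.MengerSystem u2 v2 3 b)
    {i j : Fin 3} {f g e : G.E} (hfg : f ≠ g) (h1 : [f, e] <:+: a i) (h2 : [g, e] <:+: b j) :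
    e ∈ Mrg a b := by
  have p1 := pred_of_infix h1
  have p2 := pred_of_infix h2
  refine ev_mrg ha hb (i := i) (j := j) ⟨by rw [lab_lf]; exact p1.mem, by rw [lab_rg]; exact p2.mem, ?_⟩
  rw [lab_lf, lab_rg]
  rintro ⟨x, h3, h4⟩
  have e1 := h3.uniq (nodup_of_sorted (sorted_of_path hr (ha.1 i))) p1
  have e2 := h4.uniq (nodup_of_sorted (sorted_of_path hr (hb.1 j))) p2
  rw [e1] at e2
  exact hfg (Option.some.inj e2)

end Graph

theorem upper : MAtMost ![3, 3] 13 := by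
  classical
  intro G S R hcfg _
  obtain ⟨hac, -, hcut⟩ := hcfg
  obtain ⟨⟨a0, ha0⟩, -⟩ := hcut 0
  obtain ⟨⟨b0, hb0⟩, -⟩ := hcut 1
  change Fin 3 → List G.E at a0
  change Fin 3 → List G.E at b0
  change G.MengerSystem (S 0) (R 0) 3 a0 at ha0
  change G.MengerSystem (S 1) (R 1) 3 b0 at hb0
  have hex : ∃ n, ∃ a b : Fin 3 → List G.E, G.MengerSystem (S 0) (R 0) 3 a ∧
      G.MengerSystem (S 1) (R 1) 3 b ∧ (Mrg a b).ncard = n := ⟨_, a0, b0, ha0, hb0, rfl⟩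
  obtain ⟨a, b, ha, hb, hab⟩ := Nat.find_spec hex
  have hmin : Minl G (S 0) (R 0) (S 1) (R 1) a b := by
    refine ⟨ha, hb, fun a' b' ha' hb' => ?_⟩
    rw [hab]
    exact Nat.find_min' hex ⟨a', b', ha', hb', rfl⟩
  obtain ⟨r, -, hr, -⟩ := exists_rank G hac
  let α : (i : Fin 2) → Fin ((![3, 3] : Fin 2 → ℕ) i) → List G.E := fun i =>
    match i with
    | 0 => a
    | 1 => b
  refine ⟨α, ?_, ?_⟩
  · intro i
    match i with
    | 0 => exact ha
    | 1 => exact hb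
  · refine le_trans ?_ (minl_bound hac hmin)
    haveI := G.fintE
    apply Set.ncard_le_ncard _ (Set.toFinite _)
    rintro e ⟨i, j, hij, x, y, f, g, hfg, h1, h2⟩
    match i, j with
    | 0, 0 => exact (hij rfl).elim
    | 1, 1 => exact (hij rfl).elim
    | 0, 1 => exact merging_mrg hr ha hb (i := x) (j := y) hfg h1 h2
    | 1, 0 => exact merging_mrg hr ha hb (i := y) (j := x) hfg.symm h2 h1

end M33

namespace M33

open MultiDigraph

section Lower

def srcL : List (Fin 30) := [2, 4, 6, 8, 10, 12, 14, 16, 18, 20, 22, 24, 26, 0, 3, 5, 7, 17, 25, 0, 9, 19, 21, 23, 0, 11, 13, 15, 27, 1, 3, 13, 23, 25, 27, 1, 5, 15, 17, 19, 1, 7, 9, 11, 21]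

def dstL : List (Fin 30) := [3, 5, 7, 9, 11, 13, 15, 17, 19, 21, 23, 25, 27, 2, 4, 6, 16, 24, 28, 8, 18, 20, 22, 28, 10, 12, 14, 26, 28, 2, 12, 22, 24, 26, 29, 4, 14, 16, 18, 29, 6, 8, 10, 20, 29]

/-- The extremal graph: edges 0 to 12 are the shared ones. -/
def G0 : MultiDigraph where
  V := Fin 30
  E := Fin 45
  fintV := inferInstance
  fintE := inferInstance
  src e := srcL.getD e.val 0
  dst e := dstL.getD e.val 0

def esrc (e : Fin 45) : Fin 30 := srcL.getD e.val 0

def edst (e : Fin 45) : Fin 30 := dstL.getD e.val 0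

def potA (v : Fin 30) : ℤ := ([17, 5, 16, 9, 8, 7, 6, 5, 16, 15, 16, 11, 10, 9, 8, 3, 4, 3, 14, 13, 12, 11, 10, 1, 2, 1, 2, 1, 0, 17] : List ℤ).getD v.val 0

def potB (v : Fin 30) : ℤ := ([3, 19, 18, 17, 18, 17, 18, 7, 6, 5, 4, 3, 16, 15, 16, 9, 8, 7, 6, 1, 2, 1, 14, 13, 12, 11, 10, 9, 19, 0] : List ℤ).getD v.val 0

def inA (k : Fin 13) : Fin 45 := ([13, 14, 15, 19, 24, 25, 26, 16, 20, 21, 22, 17, 27] : List (Fin 45)).getD k.val 0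

def inB (k : Fin 13) : Fin 45 := ([29, 35, 40, 41, 42, 30, 36, 37, 38, 43, 31, 32, 33] : List (Fin 45)).getD k.val 0

def pathA : Fin 3 → List (Fin 45) :=
  ![[13, 0, 14, 1, 15, 2, 16, 7, 17, 11, 18], [19, 3, 20, 8, 21, 9, 22, 10, 23],
    [24, 4, 25, 5, 26, 6, 27, 12, 28]]

def pathB : Fin 3 → List (Fin 45) :=
  ![[29, 0, 30, 5, 31, 10, 32, 11, 33, 12, 34], [35, 1, 36, 6, 37, 7, 38, 8, 39],
    [40, 2, 41, 3, 42, 4, 43, 9, 44]]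

/-- The change of a potential along an edge. -/
def dpot (π : Fin 30 → ℤ) (e : Fin 45) : ℤ := π (edst e) - π (esrc e)

theorem edge_lt : ∀ e : Fin 45, esrc e < edst e := by decide +kernel

theorem tele (π : Fin 30 → ℤ) : ∀ (p : List (Fin 45)) (u v : Fin 30), G0.IsPathFrom u v p →
    (p.map (dpot π)).sum = π v - π u := by
  intro p
  induction p with
  | nil => intro u v h; exact (h.1 rfl).elim
  | cons x p ih =>
    intro u v h
    obtain ⟨-, h2, h3, h4⟩ := h
    have hx : esrc x = u := h3 x rfl
    cases p with
    | nil =>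
      have hy : edst x = v := h4 x rfl
      simp [dpot, hx, hy]
    | cons y p =>
      have hc := List.isChain_cons_cons.1 h2
      have := ih (edst x) v ⟨List.cons_ne_nil _ _, hc.2, ?_, ?_⟩
      · rw [List.map_cons, List.sum_cons, this, dpot, hx]; ring
      · intro e he
        cases he
        exact hc.1.symm
      · intro e he
        exact h4 e ((congrArg (fun o => e ∈ o) (List.getLast?_cons_cons (a := x) (b := y) (l := p))).mpr he)

theorem tele_pos (p : List (Fin 45)) (hp : p ≠ []) :
    0 < (p.map (dpot fun v => (v.val : ℤ))).sum := by
  apply List.sum_pos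
  · intro x hx
    obtain ⟨e, -, rfl⟩ := List.mem_map.1 hx
    have := edge_lt e
    rw [Fin.lt_def] at this
    simp only [dpot]
    omega
  · simpa using hp

theorem G0_acyclic : G0.Acyclic := by
  intro v p h
  have h1 := tele (fun v => (v.val : ℤ)) p v v h
  have h2 := tele_pos p h.1
  rw [h1] at h2
  simp at h2

theorem G0_nodup {u v : Fin 30} {p : List (Fin 45)} (h : G0.IsPathFrom u v p) : p.Nodup := by
  refine nodup_of_sorted (r := fun e => (esrc e).val) (sorted_of_path (G := G0) ?_ h)
  intro f e hfe
  have h1 := edge_lt f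
  have h2 : edst f = esrc e := hfe
  rw [h2] at h1
  exact h1

theorem menger_uniq (π : Fin 30 → ℤ) (A : Finset (Fin 45)) {u v : Fin 30}
    (hA1 : ∀ e ∈ A, dpot π e < 0) (hA2 : ∀ e, e ∉ A → 0 < dpot π e)
    (hA3 : ∑ e ∈ A, dpot π e = 3 * (π v - π u))
    {a : Fin 3 → List (Fin 45)} (ha : G0.MengerSystem u v 3 a) (e : Fin 45) :
    (∃ i, e ∈ a i) ↔ e ∈ A := by
  let T : Finset (Fin 45) := Finset.univ.biUnion fun i => (a i).toFinset
  have hT : ∀ e, e ∈ T ↔ ∃ i, e ∈ a i := by intro e; simp [T]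
  have hsum : ∑ e ∈ T, dpot π e = 3 * (π v - π u) := by
    rw [Finset.sum_biUnion]
    · rw [Finset.sum_congr rfl (g := fun _ => π v - π u)]
      · rw [Finset.sum_const, Finset.card_univ, Fintype.card_fin]; simp
      · intro i _
        rw [List.sum_toFinset _ (G0_nodup (ha.1 i))]
        exact tele π _ _ _ (ha.1 i)
    · intro i _ j _ hij
      rw [Function.onFun, Finset.disjoint_left]
      intro e h1 h2
      exact ha.2 i j hij e ((List.mem_toFinset (α := Fin 45)).1 h1) ((List.mem_toFinset (α := Fin 45)).1 h2)
  have hz : ∑ e, ((if e ∈ T then dpot π e else 0) - (if e ∈ A then dpot π e else 0)) = 0 := by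
    rw [Finset.sum_sub_distrib, Finset.sum_ite_mem, Finset.sum_ite_mem, Finset.univ_inter,
      Finset.univ_inter, hsum, hA3, sub_self]
  rw [Finset.sum_eq_zero_iff_of_nonneg] at hz
  · have := hz e (Finset.mem_univ e)
    rw [← hT]
    by_cases h1 : e ∈ T <;> by_cases h2 : e ∈ A <;> simp only [h1, h2, if_true, if_false] at this ⊢
    · have := hA2 e h2; omega
    · have := hA1 e h2; omega
  · intro e _
    by_cases h1 : e ∈ T <;> by_cases h2 : e ∈ A <;> simp only [h1, h2, if_true, if_false]
    · simp
    · have := hA2 e h2; omega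
    · have := hA1 e h2; omega
    · simp

def setA : Finset (Fin 45) := Finset.univ.filter fun e => e.val < 29

def setB : Finset (Fin 45) := Finset.univ.filter fun e => e.val < 13 ∨ 29 ≤ e.val

theorem uniqA {a : Fin 3 → List (Fin 45)} (ha : G0.MengerSystem (0 : Fin 30) (28 : Fin 30) 3 a)
    (e : Fin 45) : (∃ i, e ∈ a i) ↔ e ∈ setA :=
  menger_uniq potA setA (by decide +kernel) (by decide +kernel) (by decide +kernel) ha e

theorem uniqB {a : Fin 3 → List (Fin 45)} (ha : G0.MengerSystem (1 : Fin 30) (29 : Fin 30) 3 a)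
    (e : Fin 45) : (∃ i, e ∈ a i) ↔ e ∈ setB :=
  menger_uniq potB setB (by decide +kernel) (by decide +kernel) (by decide +kernel) ha e

/-- Shared edge number `k`. -/
def shr (k : Fin 13) : Fin 45 := ⟨k.val, by omega⟩

theorem infix_of_pred {E : Type} {l : List E} {f e : E} (h : Pred l (some f) e) :
    [f, e] <:+: l := by
  obtain ⟨u, v, rfl, hu⟩ := h
  rw [List.getLast?_eq_some_iff] at hu
  obtain ⟨u', rfl⟩ := hu
  exact ⟨u', v, by simp⟩

theorem pred_shr {u v : Fin 30} {a : Fin 3 → List (Fin 45)} {A : Finset (Fin 45)}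
    {inn : Fin 13 → Fin 45}
    (ha : G0.MengerSystem u v 3 a) (hA : ∀ e, (∃ i, e ∈ a i) ↔ e ∈ A)
    (h1 : ∀ k, shr k ∈ A) (h2 : ∀ k, esrc (shr k) ≠ u)
    (h3 : ∀ k, ∀ f ∈ A, edst f = esrc (shr k) → f = inn k) (k : Fin 13) :
    ∃ i, [inn k, shr k] <:+: a i := by
  obtain ⟨i, hi⟩ := (hA (shr k)).2 (h1 k)
  obtain ⟨o, ho⟩ := exists_pred hi
  cases o with
  | none => exact (h2 k ((ha.1 i).2.2.1 _ (head_pred.2 ho))).elim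
  | some f =>
    have hf : edst f = esrc (shr k) := chain_iff_pred.1 (ha.1 i).2.1 f _ ho
    have hin := infix_of_pred ho
    have := h3 k f ((hA f).1 ⟨i, hin.subset (by simp)⟩) hf
    subst this
    exact ⟨i, hin⟩

theorem not_four {u v : Fin 30} (hu : (Finset.univ.filter fun e => esrc e = u).card = 3) :
    ¬ ∃ a : Fin (3 + 1) → List (Fin 45), G0.MengerSystem u v (3 + 1) a := by
  rintro ⟨a, ha⟩
  let f : Fin 4 → Fin 45 := fun i => (a i).head (ha.1 i).1
  have hinj : Function.Injective f := by
    intro i j hij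
    by_contra hne
    refine ha.2 i j hne (f i) (List.head_mem _) ?_
    rw [hij]; exact List.head_mem _
  have hle : (Finset.univ.image f).card ≤ (Finset.univ.filter fun e => esrc e = u).card := by
    apply Finset.card_le_card
    intro e he
    obtain ⟨i, -, rfl⟩ := Finset.mem_image.1 he
    rw [Finset.mem_filter]
    exact ⟨Finset.mem_univ _, (ha.1 i).2.2.1 _ (List.head?_eq_some_head _)⟩
  rw [Finset.card_image_of_injective _ hinj, hu] at hle
  simp at hle

theorem path_of_dec {u v : Fin 30} {p : List (Fin 45)} (h1 : p ≠ [])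
    (h2 : p.IsChain fun e f => edst e = esrc f) (h3 : p.head?.map esrc = some u)
    (h4 : p.getLast?.map edst = some v) : G0.IsPathFrom u v p := by
  refine ⟨h1, h2, ?_, ?_⟩
  · intro e he
    have he : p.head? = some e := he
    rw [he] at h3
    exact Option.some.inj h3
  · intro e he
    have he : p.getLast? = some e := he
    rw [he] at h4
    exact Option.some.inj h4

theorem mengerA : G0.MengerSystem (0 : Fin 30) (28 : Fin 30) 3 pathA := by
  refine ⟨fun i => path_of_dec ?_ ?_ ?_ ?_, ?_⟩
  · revert i; decide +kernel
  · revert i; decide +kernel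
  · revert i; decide +kernel
  · revert i; decide +kernel
  · change ∀ i j : Fin 3, i ≠ j → ∀ e : Fin 45, e ∈ pathA i → e ∉ pathA j
    decide +kernel

theorem mengerB : G0.MengerSystem (1 : Fin 30) (29 : Fin 30) 3 pathB := by
  refine ⟨fun i => path_of_dec ?_ ?_ ?_ ?_, ?_⟩
  · revert i; decide +kernel
  · revert i; decide +kernel
  · revert i; decide +kernel
  · revert i; decide +kernel
  · change ∀ i j : Fin 3, i ≠ j → ∀ e : Fin 45, e ∈ pathB i → e ∉ pathB j
    decide +kernel

theorem lower : MAtLeast ![3, 3] 13 := by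
  classical
  let S : Fin 2 → Fin 30 := ![0, 1]
  let R : Fin 2 → Fin 30 := ![28, 29]
  refine ⟨G0, S, R, ⟨G0_acyclic, ?_, ?_⟩, ?_, ?_⟩
  · change Function.Injective (![28, 29] : Fin 2 → Fin 30)
    decide
  · intro i
    match i with
    | 0 => exact ⟨⟨pathA, mengerA⟩, not_four (by decide +kernel)⟩
    | 1 => exact ⟨⟨pathB, mengerB⟩, not_four (by decide +kernel)⟩
  · change Function.Injective (![0, 1] : Fin 2 → Fin 30)
    decide
  · intro α hα
    have ha : G0.MengerSystem (0 : Fin 30) (28 : Fin 30) 3 (α 0) := hα 0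
    have hb : G0.MengerSystem (1 : Fin 30) (29 : Fin 30) 3 (α 1) := hα 1
    have hA := pred_shr (inn := inA) ha (uniqA ha) (by decide +kernel) (by decide +kernel)
      (by decide +kernel)
    have hB := pred_shr (inn := inB) hb (uniqB hb) (by decide +kernel) (by decide +kernel)
      (by decide +kernel)
    have hne : ∀ k, inA k ≠ inB k := by decide +kernel
    have hinj : Function.Injective shr := by
      intro i j h
      have := congrArg Fin.val h
      exact Fin.ext this
    have hc : (Set.range shr).ncard = 13 := by
      rw [← Set.image_univ, Set.ncard_image_of_injective _ hinj]
      simp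
    rw [← hc]
    have hfin : Finite G0.E := inferInstanceAs (Finite (Fin 45))
    refine Set.ncard_le_ncard (t := {e : G0.E | G0.MergingEdge α e}) ?_ (Set.toFinite _)
    rintro _ ⟨k, rfl⟩
    obtain ⟨i, hi⟩ := hA k
    obtain ⟨j, hj⟩ := hB k
    exact ⟨0, 1, by decide, i, j, inA k, inB k, hne k, hi, hj⟩

end Lower

end M33

/-- `M(3, 3) = 13`. -/
theorem M_three_three : MEq ![3, 3] 13 := by
  exact ⟨M33.upper, M33.lower⟩
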